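/- Let H be a complex Hilbert space, let T : H →L[ℂ] H be a positive bounded operator (self-adjoint with ⟪T ψ, ψ⟫ real and nonnegative for all ψ) whose kernel is trivial, and let ε > 0. If ‖T ψ‖² ≥ ε * re ⟪T ψ, ψ⟫ for every ψ ∈ H, then re ⟪T ψ, ψ⟫ ≥ ε * ‖ψ‖² for every ψ ∈ H. -/

import Mathlib

open scoped InnerProductSpace

/-- The analytic core of Proposition 3.9 of the paper: for a positive bounded
operator `T` with trivial kernel on a complex Hilbert space, the inequality
`‖Tψ‖² ≥ ε·re⟪Tψ, ψ⟫` for all `ψ` upgrades to `re⟪Tψ, ψ⟫ ≥ ε‖ψ‖²` for all `ψ`. -/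
theorem stmt_9 (H : Type*) [NormedAddCommGroup H] [InnerProductSpace ℂ H]
    [CompleteSpace H] (T : H →L[ℂ] H) (hT : T.IsPositive)
    (hker : LinearMap.ker (T : H →ₗ[ℂ] H) = ⊥)
    (ε : ℝ) (hε : 0 < ε)
    (h : ∀ ψ : H, ‖T ψ‖^2 ≥ ε * (⟪T ψ, ψ⟫_ℂ).re) :
    ∀ ψ : H, (⟪T ψ, ψ⟫_ℂ).re ≥ ε * ‖ψ‖^2 := by
  obtain ⟨S, hS, hSS⟩ : ∃ S : H →L[ℂ] H, IsSelfAdjoint S ∧ S * S = T := by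
    have h0 : 0 ≤ T := (ContinuousLinearMap.nonneg_iff_isPositive T).2 hT
    exact ⟨CFC.sqrt T, IsSelfAdjoint.of_nonneg (CFC.sqrt_nonneg T),
      CFC.sqrt_mul_sqrt_self T h0⟩
  have hTS : ∀ x, T x = S (S x) := fun x => by rw [← hSS]; rfl
  have hadj : ContinuousLinearMap.adjoint S = S := hS
  have hin : ∀ x, (⟪T x, x⟫_ℂ).re = ‖S x‖ ^ 2 := by
    intro x
    have h1 : ⟪T x, x⟫_ℂ = ⟪S x, S x⟫_ℂ := by
      rw [hTS]
      conv_lhs => rw [← hadj]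
      rw [ContinuousLinearMap.adjoint_inner_left, hadj]
    rw [h1]
    exact inner_self_eq_norm_sq (𝕜 := ℂ) (S x)
  have hdense : DenseRange S := by
    have hk : S.ker = ⊥ := by
      rw [eq_bot_iff]
      intro x hx
      have hx' : S x = 0 := hx
      rw [← hker]
      show T x = 0
      rw [hTS, hx', map_zero]
    have h2 : S.rangeᗮ = ⊥ := by
      rw [ContinuousLinearMap.orthogonal_range, hadj, hk]
    have h3 := Submodule.topologicalClosure_eq_top_iff.2 h2
    have h4 := (Submodule.dense_iff_topologicalClosure_eq_top).2 h3
    have h5 : ((S.range : Submodule ℂ H) : Set H) = Set.range S := by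
      ext x
      rfl
    rw [h5] at h4
    exact h4
  intro ψ
  rw [hin]
  refine hdense.induction_on (p := fun ψ => ‖S ψ‖ ^ 2 ≥ ε * ‖ψ‖ ^ 2) ψ ?_ ?_
  · exact isClosed_le (by fun_prop) (by fun_prop)
  · intro φ
    have := h φ
    rwa [hin, hTS] at this
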